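/- For every integer k ≥ 1 and every n ∈ ℕ, the total Bernoulli-p_k weight of the strings of k-length n is at least q_k^{-k}; that is, s_k^n · q_k^{-n} ≥ q_k^{-k} (equivalently, s_k^n · p_k^n ≥ p_k^k). -/

import Mathlib

/-- The `k`-length of a finite binary string: `ℓ_k(σ) = #₀(σ) + k·#₁(σ)`. -/
def klen (k : ℕ) (σ : List Bool) : ℕ := σ.count false + k * σ.count true

/-- `s_k^n`: the number of binary strings of `k`-length exactly `n`. -/
noncomputable def skn (k n : ℕ) : ℕ := Set.ncard {σ : List Bool | klen k σ = n}

lemma klen_false_cons (k : ℕ) (σ : List Bool) : klen k (false :: σ) = klen k σ + 1 := by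
  simp [klen]
  ring

lemma klen_true_cons (k : ℕ) (σ : List Bool) : klen k (true :: σ) = klen k σ + k := by
  simp [klen]
  ring

lemma length_le_klen {k : ℕ} (hk : 1 ≤ k) (σ : List Bool) : σ.length ≤ klen k σ := by
  induction σ with
  | nil => simp
  | cons b σ ih =>
    cases b
    · rw [klen_false_cons, List.length_cons]
      lia
    · rw [klen_true_cons, List.length_cons]
      lia

lemma finite_setOf_klen_eq {k : ℕ} (hk : 1 ≤ k) (n : ℕ) : {σ : List Bool | klen k σ = n}.Finite :=
  (List.finite_length_le Bool n).subset fun σ hσ => (length_le_klen hk σ).trans_eq hσ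

lemma one_le_skn {k : ℕ} (hk : 1 ≤ k) (n : ℕ) : 1 ≤ skn k n :=
  (Set.ncard_pos (finite_setOf_klen_eq hk n)).2 ⟨List.replicate n false, by simp [klen, List.count_replicate]⟩

lemma skn_add_skn_le {k : ℕ} (hk : 1 ≤ k) {a b n : ℕ} (ha : a + 1 = n) (hb : b + k = n) :
    skn k a + skn k b ≤ skn k n := by
  unfold skn
  rw [← Set.ncard_image_of_injective {σ | klen k σ = a} (List.cons_injective (a := false)),
    ← Set.ncard_image_of_injective {σ | klen k σ = b} (List.cons_injective (a := true)),
    ← Set.ncard_union_eq ?_ ((finite_setOf_klen_eq hk a).image _)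
      ((finite_setOf_klen_eq hk b).image _)]
  · refine Set.ncard_le_ncard ?_ (finite_setOf_klen_eq hk n)
    rintro _ (⟨σ, rfl, rfl⟩ | ⟨σ, rfl, rfl⟩)
    · exact (klen_false_cons k σ).trans ha
    · exact (klen_true_cons k σ).trans hb
  · rw [Set.disjoint_left]
    rintro _ ⟨σ, _, rfl⟩ ⟨τ, _, h⟩
    simp at h

lemma pow_le_skn_mul_pow {k : ℕ} (hk : 1 ≤ k) {p : ℝ} (hp : p ∈ Set.Ioo (0 : ℝ) 1)
    (hpk : p ^ k = 1 - p) (n : ℕ) : p ^ k ≤ (skn k n : ℝ) * p ^ n := by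
  induction n using Nat.strong_induction_on with
  | _ n ih =>
    rcases lt_or_ge n k with hn | hn
    · have h1 : (1 : ℝ) ≤ skn k n := by exact_mod_cast one_le_skn hk n
      calc p ^ k ≤ p ^ n := pow_le_pow_of_le_one hp.1.le hp.2.le hn.le
        _ ≤ skn k n * p ^ n := le_mul_of_one_le_left (pow_nonneg hp.1.le n) h1
    · obtain ⟨a, ha⟩ : ∃ a, a + 1 = n := ⟨n - 1, by lia⟩
      obtain ⟨b, hb⟩ : ∃ b, b + k = n := ⟨n - k, by lia⟩
      have hs : (skn k a : ℝ) + skn k b ≤ skn k n := by exact_mod_cast skn_add_skn_le hk ha hb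
      have hpa : p ^ n = p ^ a * p := by rw [← ha, pow_succ]
      have hpb : p ^ n = p ^ b * p ^ k := by rw [← hb, pow_add]
      calc p ^ k = p ^ k * p + p ^ k * p ^ k := by rw [← mul_add, hpk]; ring
        _ ≤ (skn k a * p ^ a) * p + (skn k b * p ^ b) * p ^ k :=
          add_le_add (mul_le_mul_of_nonneg_right (ih a (by lia)) hp.1.le)
            (mul_le_mul_of_nonneg_right (ih b (by lia)) (pow_nonneg hp.1.le k))
        _ = (skn k a + skn k b) * p ^ n := by
          rw [add_mul, mul_assoc, mul_assoc, ← hpa, ← hpb]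
        _ ≤ skn k n * p ^ n := mul_le_mul_of_nonneg_right hs (pow_nonneg hp.1.le n)

/-- For `k ≥ 1` and every `n`, the total Bernoulli-`p_k` weight of the strings of
`k`-length `n` is at least `q_k^{-k}`: `s_k^n · q_k^{-n} ≥ q_k^{-k}`
(equivalently `s_k^n · p_k^n ≥ p_k^k`). -/
theorem stmt_10 (k : ℕ) (hk : 1 ≤ k) (p : ℝ) (hp : p ∈ Set.Ioo (0 : ℝ) 1)
    (hpk : p ^ k = 1 - p) (n : ℕ) :
    (skn k n : ℝ) * (1 / p) ^ (-(n : ℤ)) ≥ (1 / p) ^ (-(k : ℤ)) ∧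
    (skn k n : ℝ) * p ^ n ≥ p ^ k := by
  have h := pow_le_skn_mul_pow hk hp hpk n
  refine ⟨?_, h⟩
  simpa only [one_div, inv_zpow', neg_neg, zpow_natCast] using h
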